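/- arXiv:1904.06981 — 2 statements merged into one kernel-verified Lean document; each statement's English description precedes it below -/
import Mathlib

section
/- Let μ, λ be positive integers with λ ≥ e·μ. Let (X_t)_{t∈ℕ} and (Δ_t)_{t∈ℕ} be stochastic processes adapted to a filtration (F_t) such that for all t: Δ_t ≥ Δ_min for some fixed real Δ_min ∈ (0, λ), X_t ∈ {0,…,μ}, and conditionally on F_t the variable X_{t+1} is distributed as min{μ, B} with B ~ Bin(λ, min{1, (X_t + Δ_t)/(e·μ)}). Let X' be a real number satisfying max{18·ln(2λ/Δ_min), 48} ≤ X' ≤ μ/2, and let T = inf{t : X_t ≥ X'}. Then E[T] ≤ max{24, (4X' − 2X_0)/Δ_min}. -/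
open Finset
open scoped ENNReal

attribute [local instance] Classical.propDecidable

/-- Search points: bit strings of length `n`. -/
abbrev Pt (n : ℕ) := Fin n → Bool

/-- The OneMax fitness: the number of one-bits. -/
noncomputable def oneMax {n : ℕ} (x : Pt n) : ℕ := (univ.filter (fun i => x i = true)).card

/-- The all-ones string (the unique optimum of OneMax). -/
noncomputable def allOnes (n : ℕ) : Pt n := fun _ => true

/-- Probability that standard-bit mutation (flip each bit independently with
probability `1/n`) turns `x` into `y`. -/
noncomputable def mutProb (n : ℕ) (x y : Pt n) : ℝ :=
  ∏ i : Fin n, (if y i = x i then 1 - 1 / (n : ℝ) else 1 / (n : ℝ))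

/-- `binomPr m p k` is the probability that a `Bin(m, p)` random variable equals `k`. -/
noncomputable def binomPr (m : ℕ) (p : ℝ) (k : ℕ) : ℝ :=
  (m.choose k : ℝ) * p ^ k * (1 - p) ^ (m - k)

/-- Probability that `min μ B = j`, where `B ~ Bin(lam, p)`. -/
noncomputable def binomTruncPr (μ lam : ℕ) (p : ℝ) (j : ℕ) : ℝ :=
  if j < μ then binomPr lam p j
  else if j = μ then ∑ k ∈ Finset.Icc μ lam, binomPr lam p k
  else 0

/-- The potential of a single individual. -/
noncomputable def gPot (n : ℕ) (τ : ℝ) (f₀ : ℕ) (x : Pt n) : ℝ :=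
  if f₀ ≤ oneMax x then τ ^ (oneMax x - f₀) else 0

/-- The potential of a population. -/
noncomputable def gPop (n μ : ℕ) (τ : ℝ) (f₀ : ℕ) (P : Fin μ → Pt n) : ℝ :=
  ∑ i, gPot n τ f₀ (P i)

/-- Probability that one offspring-creation step (choose a parent uniformly at random
from the population `P`, then apply standard-bit mutation) produces `y`. -/
noncomputable def offProb (n μ : ℕ) (P : Fin μ → Pt n) (y : Pt n) : ℝ :=
  (∑ i, mutProb n (P i) y) / (μ : ℝ)

/-- Probability that the `lam` independently created offspring are exactly `o`. -/
noncomputable def offVecProb (n μ lam : ℕ) (P : Fin μ → Pt n) (o : Fin lam → Pt n) : ℝ :=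
  ∏ j, offProb n μ P (o j)

/-- `s` selects `μ` of the `lam` offspring `o` having the largest OneMax values. -/
def validSel {n μ lam : ℕ} (o : Fin lam → Pt n) (s : Fin μ → Fin lam) : Prop :=
  Function.Injective s ∧
    ∀ j : Fin lam, (∀ i, s i ≠ j) → ∀ i, oneMax (o j) ≤ oneMax (o (s i))

/-- Transition probability of the (μ,λ) EA on OneMax: the probability that the next
population is `Q`, given that the current one is `P`; the `μ` best of the `lam`
offspring are selected, ties broken uniformly at random. -/
noncomputable def stepProb (n μ lam : ℕ) (P Q : Fin μ → Pt n) : ℝ :=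
  ∑ o : Fin lam → Pt n, offVecProb n μ lam P o *
    (((univ.filter (fun s : Fin μ → Fin lam => validSel o s ∧ o ∘ s = Q)).card : ℝ) /
      ((univ.filter (fun s : Fin μ → Fin lam => validSel o s)).card : ℝ))

/-- Probability of observing the population path `path`, where the initial population
consists of `μ` individuals chosen independently and uniformly at random. -/
noncomputable def pathProb (n μ lam : ℕ) {t : ℕ} (path : Fin (t + 1) → Fin μ → Pt n) : ℝ :=
  ((1 : ℝ) / 2 ^ n) ^ μ * ∏ s : Fin t, stepProb n μ lam (path s.castSucc) (path s.succ)

/-- Probability that none of the populations `P_0, …, P_t` contains the optimum. -/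
noncomputable def survProb (n μ lam t : ℕ) : ℝ :=
  ∑ path ∈ (univ : Finset (Fin (t + 1) → Fin μ → Pt n)).filter
      (fun path => ∀ s i, path s i ≠ allOnes n),
    pathProb n μ lam path

/-- Expected number of generations of the (μ,λ) EA on OneMax until the all-ones
string is first generated. -/
noncomputable def expGens (n μ lam : ℕ) : ℝ≥0∞ :=
  ∑' t : ℕ, ENNReal.ofReal (survProb n μ lam t)

/-- Expected runtime (number of fitness evaluations) of the (μ,λ) EA on OneMax:
`μ` evaluations for the initial population plus `lam` per generation. -/
noncomputable def expRuntime (n μ lam : ℕ) : ℝ≥0∞ :=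
  (μ : ℝ≥0∞) + (lam : ℝ≥0∞) * expGens n μ lam

/-- Number of individuals of the population with fitness exactly `φ`. -/
noncomputable def cntEq {n μ : ℕ} (P : Fin μ → Pt n) (φ : ℕ) : ℕ :=
  (univ.filter (fun i => oneMax (P i) = φ)).card

/-- Number of individuals of the population with fitness strictly greater than `φ`. -/
noncomputable def cntGt {n μ : ℕ} (P : Fin μ → Pt n) (φ : ℕ) : ℕ :=
  (univ.filter (fun i => φ < oneMax (P i))).card

/-- `φ` is the current level at generation `t` of the population path `path`. -/
def isCurLevel {n : ℕ} (μ : ℕ) (path : ℕ → Fin μ → Pt n) (t φ : ℕ) : Prop :=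
  ∃ t₀ < t, (μ : ℝ) / 2 ≤ (cntEq (path t₀) φ : ℝ) + (cntGt (path t₀) φ : ℝ) ∧
    ∀ τ, t₀ ≤ τ → τ ≤ t →
      (μ : ℝ) / 4 ≤ (cntEq (path τ) φ : ℝ) + (cntGt (path τ) φ : ℝ) ∧
        (cntGt (path τ) φ : ℝ) < (μ : ℝ) / 2

/-- Probability that the population path of length `t + 1` of the (μ,λ) EA started
from the fixed population `P₀` satisfies the predicate `good`. -/
noncomputable def prEvent (n μ lam : ℕ) (P₀ : Fin μ → Pt n) (t : ℕ)
    (good : (Fin (t + 1) → Fin μ → Pt n) → Prop) : ℝ :=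
  ∑ path ∈ (univ : Finset (Fin (t + 1) → Fin μ → Pt n)).filter
      (fun path => path 0 = P₀ ∧ good path),
    ∏ s : Fin t, stepProb n μ lam (path s.castSucc) (path s.succ)

/-- The population `Q` has lost the level `φ`: fewer than `μ/4` individuals have
fitness at least `φ`. -/
def lostLevel {n μ : ℕ} (φ : ℕ) (Q : Fin μ → Pt n) : Prop :=
  (cntEq Q φ : ℝ) + (cntGt Q φ : ℝ) < (μ : ℝ) / 4

/-- The population `Q` has gained a level over `φ`: at least `μ/2` individuals have
fitness strictly greater than `φ`. -/
def gainLevel {n μ : ℕ} (φ : ℕ) (Q : Fin μ → Pt n) : Prop :=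
  (μ : ℝ) / 2 ≤ (cntGt Q φ : ℝ)

/-- Probability that the process of STATEMENT 6 stays strictly below `X'` during the
first `t + 1` steps, i.e. `Pr[T > t]`.  The transition from time `s` uses the success
probability `min{1, (X_s + Δ_s)/(eμ)}`, where `Δ_s` may depend on the history. -/
noncomputable def survBelow (μ lam : ℕ) (Δ : ℕ → (ℕ → ℕ) → ℝ) (X₀ : ℕ) (X' : ℝ)
    (t : ℕ) : ℝ :=
  ∑ path ∈ (univ : Finset (Fin (t + 1) → Fin (μ + 1))).filter
      (fun path => (path 0).val = X₀ ∧ ∀ s : Fin (t + 1), ((path s).val : ℝ) < X'),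
    ∏ s : Fin t,
      binomTruncPr μ lam
        (min 1 ((((path s.castSucc).val : ℝ) +
            Δ s.val (fun u => if hu : u < t + 1 then (path ⟨u, hu⟩).val else 0)) /
          (Real.exp 1 * (μ : ℝ))))
        (path s.succ).val

lemma binomPr_nonneg' (m : ℕ) (p : ℝ) (h0 : 0 ≤ p) (h1 : p ≤ 1) (k : ℕ) : 0 ≤ binomPr m p k := by
  unfold binomPr
  have : 0 ≤ 1 - p := by linarith
  positivity

lemma binom_mgf (m : ℕ) (p : ℝ) (h0 : 0 ≤ p) (h1 : p ≤ 1) (θ : ℝ) :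
    ∑ k ∈ range (m + 1), binomPr m p k * Real.exp (θ * k)
      ≤ Real.exp (m * p * (Real.exp θ - 1)) := by
  have h : ∑ k ∈ range (m + 1), binomPr m p k * Real.exp (θ * k)
      = (p * Real.exp θ + (1 - p)) ^ m := by
    rw [add_pow]
    refine Finset.sum_congr rfl fun k _ => ?_
    unfold binomPr
    rw [mul_comm θ, Real.exp_nat_mul, mul_pow]
    ring
  rw [h]
  have h2 : p * Real.exp θ + (1 - p) ≤ Real.exp (p * (Real.exp θ - 1)) := by
    have := Real.add_one_le_exp (p * (Real.exp θ - 1))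
    linarith
  have h3 : 0 ≤ p * Real.exp θ + (1 - p) := by
    have := mul_nonneg h0 (Real.exp_pos θ).le
    linarith
  calc _ ≤ (Real.exp (p * (Real.exp θ - 1))) ^ m := pow_le_pow_left₀ h3 h2 m
    _ = _ := by rw [← Real.exp_nat_mul]; ring_nf

lemma binom_one (m : ℕ) (p : ℝ) : ∑ k ∈ range (m + 1), binomPr m p k = 1 := by
  have h : ∑ k ∈ range (m + 1), binomPr m p k = (p + (1 - p)) ^ m := by
    rw [add_pow]
    refine Finset.sum_congr rfl fun k _ => ?_
    unfold binomPr
    ring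
  rw [h]; simp

lemma binom_mean (m : ℕ) (p : ℝ) : ∑ k ∈ range (m + 1), binomPr m p k * k = m * p := by
  have h := congrArg (Polynomial.eval p) (bernsteinPolynomial.sum_smul ℝ m)
  simp only [Polynomial.eval_finsetSum, bernsteinPolynomial, nsmul_eq_mul, Polynomial.eval_mul,
    Polynomial.eval_natCast, Polynomial.eval_pow, Polynomial.eval_X, Polynomial.eval_sub,
    Polynomial.eval_one] at h
  rw [← h]
  refine Finset.sum_congr rfl fun k _ => ?_
  unfold binomPr
  ring

lemma stepA (m : ℕ) (p : ℝ) (h0 : 0 ≤ p) (h1 : p ≤ 1) (a K D : ℝ) (ha : 48 ≤ a) (hK0 : 0 ≤ K)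
    (hm : m * p ≤ 3 / 2 * a) (hK : ∀ k : ℕ, k ≤ m → (k : ℝ) - 2 * a ≤ K * Real.exp (1/3 * (k - 2 * a)))
    (hKD : K * Real.exp (-a / 18) ≤ D / 2) :
    ∑ k ∈ range (m + 1), binomPr m p k * max 0 (2 * a - k) ≤ 2 * a - m * p + D / 2 := by
  have hb : ∀ k ∈ range (m + 1), binomPr m p k * max 0 (2 * a - k) ≤
      2 * a * binomPr m p k - binomPr m p k * k
        + K * Real.exp (- (2/3) * a) * (binomPr m p k * Real.exp (1/3 * k)) := by
    intro k hk
    have hn := binomPr_nonneg' m p h0 h1 k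
    have e1 : K * Real.exp (1/3 * (k - 2 * a)) = K * Real.exp (- (2/3) * a) * Real.exp (1/3 * k) := by
      rw [mul_assoc, ← Real.exp_add]; ring_nf
    have h2 := hK k (by simpa [Nat.lt_succ_iff] using hk)
    have h3 : max 0 (2 * a - k) ≤ 2 * a - k + K * Real.exp (1/3 * (k - 2 * a)) := by
      apply max_le
      · linarith
      · have := mul_nonneg hK0 (Real.exp_pos (1/3 * (k - 2 * a))).le
        linarith
    rw [e1] at h3
    have := mul_le_mul_of_nonneg_left h3 hn
    linarith
  refine (Finset.sum_le_sum hb).trans ?_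
  rw [Finset.sum_add_distrib, Finset.sum_sub_distrib, ← Finset.mul_sum, ← Finset.mul_sum,
    binom_one, binom_mean]
  have hc : Real.exp (1/3) ≤ 38 / 27 := by
    have h3 : Real.exp (1/3) ^ 3 = Real.exp 1 := by
      rw [← Real.exp_nat_mul]; norm_num
    have := Real.exp_one_lt_d9
    by_contra hcon
    push Not at hcon
    have : (38/27:ℝ)^3 < Real.exp (1/3) ^ 3 := by gcongr
    norm_num at this
    norm_num at h3
    linarith
  have hc1 : 0 ≤ Real.exp (1/3) - 1 := by
    have := Real.add_one_le_exp (1/3:ℝ); linarith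
  have hg := binom_mgf m p h0 h1 (1/3)
  have hexp : Real.exp (m * p * (Real.exp (1/3) - 1)) ≤ Real.exp (11/18 * a) := by
    apply Real.exp_le_exp.2
    have := mul_le_mul hm (by linarith : Real.exp (1/3) - 1 ≤ 11/27) hc1 (by linarith)
    linarith
  have : K * Real.exp (- (2/3) * a) * ∑ k ∈ range (m + 1), binomPr m p k * Real.exp (1/3 * k)
      ≤ K * Real.exp (- (2/3) * a) * Real.exp (11/18 * a) :=
    mul_le_mul_of_nonneg_left (hg.trans hexp) (by positivity)
  have e2 : - (2/3) * a + 11/18 * a = -a/18 := by ring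
  have e3 : K * Real.exp (- (2/3) * a) * Real.exp (11/18 * a) = K * Real.exp (-a / 18) := by
    rw [mul_assoc, ← Real.exp_add, e2]
  linarith

lemma stepB (m : ℕ) (p : ℝ) (h0 : 0 ≤ p) (h1 : p ≤ 1) (a : ℝ) (ha : 48 ≤ a)
    (hm : 3 / 2 * a ≤ m * p) :
    ∑ k ∈ range (m + 1), binomPr m p k * max 0 (2 * a - k) ≤ 3 / 4 * a := by
  have hap : 0 < a := by linarith
  have hb : ∀ k ∈ range (m + 1), binomPr m p k * max 0 (2 * a - k) ≤
      a / 2 * Real.exp 3 * (binomPr m p k * Real.exp (-(2/a) * k)) := by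
    intro k hk
    have hn := binomPr_nonneg' m p h0 h1 k
    have h3 : max 0 (2 * a - k) ≤ a / 2 * Real.exp 3 * Real.exp (-(2/a) * k) := by
      apply max_le
      · positivity
      · rw [mul_assoc, ← Real.exp_add]
        have h4 := Real.add_one_le_exp (3 + -(2/a) * (k:ℝ))
        have h5 : (2 * a - k : ℝ) = a / 2 * (3 + -(2/a) * (k:ℝ) + 1) := by
          field_simp; ring
        rw [h5]
        gcongr
    have := mul_le_mul_of_nonneg_left h3 hn
    linarith
  refine (Finset.sum_le_sum hb).trans ?_
  rw [← Finset.mul_sum]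
  have hg := binom_mgf m p h0 h1 (-(2/a))
  have h6 : Real.exp (-(2/a)) ≤ 1 - 2 / (a + 2) := by
    rw [Real.exp_neg]
    have h7 := Real.add_one_le_exp (2/a)
    have h8 : (1 - 2 / (a + 2) : ℝ) = (2/a + 1)⁻¹ := by
      field_simp; ring
    rw [h8]
    gcongr
  have h9 : m * p * (Real.exp (-(2/a)) - 1) ≤ -3 + 6/50 := by
    have h10 : Real.exp (-(2/a)) - 1 ≤ - (2 / (a+2)) := by linarith
    have h11 : m * p * (Real.exp (-(2/a)) - 1) ≤ m * p * (- (2 / (a+2))) :=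
      mul_le_mul_of_nonneg_left h10 (by positivity)
    have h12 : 3 / 2 * a * (2 / (a+2)) ≤ m * p * (2 / (a+2)) :=
      mul_le_mul_of_nonneg_right hm (by positivity)
    have h13 : 3 / 2 * a * (2 / (a+2)) = 3 - 6 / (a + 2) := by field_simp; ring
    have h14 : 6 / (a + 2) ≤ 6 / 50 := by gcongr; linarith
    linarith
  have h15 := hg.trans (Real.exp_le_exp.2 h9)
  have h16 : Real.exp 3 * Real.exp (-3 + 6/50) ≤ 3 / 2 := by
    rw [← Real.exp_add]
    have : (3 + (-3 + 6/50) : ℝ) = -(-(6/50)) := by norm_num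
    rw [this, Real.exp_neg]
    have h := Real.add_one_le_exp (-(6/50) : ℝ)
    rw [inv_le_comm₀ (Real.exp_pos _) (by norm_num)]
    norm_num at h ⊢
    linarith
  calc _ ≤ a / 2 * Real.exp 3 * Real.exp (-3 + 6/50) := by gcongr
    _ = a / 2 * (Real.exp 3 * Real.exp (-3 + 6/50)) := by ring
    _ ≤ a / 2 * (3 / 2) := by gcongr
    _ = _ := by ring

lemma binomTruncPr_nonneg' (μ m : ℕ) (p : ℝ) (h0 : 0 ≤ p) (h1 : p ≤ 1) (k : ℕ) :
    0 ≤ binomTruncPr μ m p k := by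
  unfold binomTruncPr
  split_ifs
  · exact binomPr_nonneg' m p h0 h1 k
  · exact Finset.sum_nonneg fun k _ => binomPr_nonneg' m p h0 h1 k
  · exact le_rfl

/-- one-step drift -/
lemma one_step (μ lam : ℕ) (hμ : 0 < μ) (hlam : Real.exp 1 * (μ : ℝ) ≤ (lam : ℝ))
    (a K D : ℝ) (ha : 48 ≤ a) (haμ : a ≤ (μ : ℝ) / 2) (hK0 : 0 ≤ K) (hD : 0 < D) (hDa : D ≤ a / 2)
    (hK : ∀ k : ℕ, k ≤ lam → (k : ℝ) - 2 * a ≤ K * Real.exp (1/3 * (k - 2 * a)))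
    (hKD : K * Real.exp (-a / 18) ≤ D / 2)
    (x d : ℝ) (hx0 : 0 ≤ x) (hx : x < a) (hd : D ≤ d) :
    ∑ y : Fin (μ + 1), (if ((y.val : ℕ) : ℝ) < a then
        binomTruncPr μ lam (min 1 ((x + d) / (Real.exp 1 * (μ : ℝ)))) y.val
          * (2 / D * (2 * a - (y.val : ℝ))) else 0)
      ≤ 2 / D * (2 * a - x) - 1 := by
  have hμ' : (0:ℝ) < μ := by exact_mod_cast hμ
  have he : (2:ℝ) ≤ Real.exp 1 := by have := Real.add_one_le_exp (1:ℝ); linarith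
  have hlamμ : (2:ℝ) * μ ≤ lam := by nlinarith
  have hle : μ ≤ lam := by
    have : (μ:ℝ) ≤ lam := by linarith
    exact_mod_cast this
  set p := min 1 ((x + d) / (Real.exp 1 * (μ : ℝ))) with hp
  have h0 : 0 ≤ p := le_min zero_le_one (div_nonneg (by linarith) (by positivity))
  have h1 : p ≤ 1 := min_le_left _ _
  have hmean : 3 / 2 * a ≤ lam * p ∨ x + D ≤ lam * p := by
    rcases min_choice 1 ((x + d) / (Real.exp 1 * (μ : ℝ))) with h | h
    · left; rw [hp, h]; linarith
    · right
      rw [hp, h]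
      have : Real.exp 1 * μ * ((x + d) / (Real.exp 1 * (μ : ℝ))) = x + d := by
        field_simp
      have h2 := mul_le_mul_of_nonneg_right hlam
        (div_nonneg (by linarith) (by positivity) : 0 ≤ (x + d) / (Real.exp 1 * (μ : ℝ)))
      linarith
  have hE : ∑ k ∈ range (lam + 1), binomPr lam p k * max 0 (2 * a - k) ≤ 2 * a - x - D / 2 := by
    by_cases hm : 3 / 2 * a ≤ lam * p
    · have := stepB lam p h0 h1 a ha hm
      linarith
    · have := stepA lam p h0 h1 a K D ha hK0 (by linarith) hK hKD
      have := hmean.resolve_left hm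
      linarith
  have hsum : ∑ y : Fin (μ + 1), (if ((y.val : ℕ) : ℝ) < a then
        binomTruncPr μ lam p y.val * (2 / D * (2 * a - (y.val : ℝ))) else 0)
      ≤ 2 / D * ∑ k ∈ range (lam + 1), binomPr lam p k * max 0 (2 * a - k) := by
    rw [Fin.sum_univ_eq_sum_range (fun y => if ((y : ℕ) : ℝ) < a then
        binomTruncPr μ lam p y * (2 / D * (2 * a - (y : ℝ))) else 0) (μ + 1), Finset.mul_sum]
    calc _ ≤ ∑ k ∈ range (μ + 1), 2 / D * (binomPr lam p k * max 0 (2 * a - k)) := by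
          refine Finset.sum_le_sum fun k _ => ?_
          have hn := binomPr_nonneg' lam p h0 h1 k
          split_ifs with hk
          · have hkμ : k < μ := by
              have : (k:ℝ) < μ := by linarith
              exact_mod_cast this
            unfold binomTruncPr
            rw [if_pos hkμ]
            have : 2 * a - k ≤ max 0 (2 * a - k) := le_max_right _ _
            have h2 : binomPr lam p k * (2 * a - k) ≤ binomPr lam p k * max 0 (2 * a - k) := by gcongr
            have h3 := mul_le_mul_of_nonneg_left h2 (by positivity : 0 ≤ 2 / D)
            linarith
          · have : 0 ≤ max 0 (2 * a - k) := le_max_left _ _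
            positivity
      _ ≤ _ := by
          refine Finset.sum_le_sum_of_subset_of_nonneg (Finset.range_subset_range.2 (by omega)) ?_
          intro k _ _
          have hn := binomPr_nonneg' lam p h0 h1 k
          have : 0 ≤ max 0 (2 * a - (k:ℝ)) := le_max_left _ _
          positivity
  refine hsum.trans ?_
  have := mul_le_mul_of_nonneg_left hE (by positivity : 0 ≤ 2 / D)
  have e : 2 / D * (2 * a - x - D / 2) = 2 / D * (2 * a - x) - 1 := by field_simp
  linarith

noncomputable def pw (μ lam : ℕ) (Δ : ℕ → (ℕ → ℕ) → ℝ) (t : ℕ)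
    (path : Fin (t + 1) → Fin (μ + 1)) : ℝ :=
  ∏ s : Fin t,
      binomTruncPr μ lam
        (min 1 ((((path s.castSucc).val : ℝ) +
            Δ s.val (fun u => if hu : u < t + 1 then (path ⟨u, hu⟩).val else 0)) /
          (Real.exp 1 * (μ : ℝ))))
        (path s.succ).val

noncomputable def hist (μ t : ℕ) (path : Fin (t + 1) → Fin (μ + 1)) : ℕ → ℕ :=
  fun u => if hu : u < t + 1 then (path ⟨u, hu⟩).val else 0

lemma pw_snoc (μ lam : ℕ) (Δ : ℕ → (ℕ → ℕ) → ℝ)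
    (hadapted : ∀ t (h h' : ℕ → ℕ), (∀ s ≤ t, h s = h' s) → Δ t h = Δ t h') (t : ℕ)
    (path : Fin (t + 1) → Fin (μ + 1)) (y : Fin (μ + 1)) :
    pw μ lam Δ (t + 1) (Fin.snoc (α := fun _ => Fin (μ + 1)) path y) = pw μ lam Δ t path *
      binomTruncPr μ lam (min 1 ((((path (Fin.last t)).val : ℝ) + Δ t (hist μ t path)) /
          (Real.exp 1 * (μ : ℝ)))) y.val := by
  have hh : ∀ u ≤ t, hist μ (t + 1) (Fin.snoc (α := fun _ => Fin (μ + 1)) path y) u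
      = hist μ t path u := by
    intro u hu
    unfold hist
    rw [dif_pos (by omega), dif_pos (by omega)]
    have : (⟨u, by omega⟩ : Fin (t + 1 + 1)) = (⟨u, by omega⟩ : Fin (t+1)).castSucc := rfl
    rw [this, Fin.snoc_castSucc]
  have hΔ' : ∀ s ≤ t, Δ s (hist μ (t + 1) (Fin.snoc (α := fun _ => Fin (μ + 1)) path y))
      = Δ s (hist μ t path) :=
    fun s hs => hadapted s _ _ fun u hu => hh u (hu.trans hs)
  unfold pw
  rw [Fin.prod_univ_castSucc]
  congr 1
  · refine Finset.prod_congr rfl fun s _ => ?_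
    have h1 := hΔ' s.val s.isLt.le
    unfold hist at h1
    rw [Fin.snoc_castSucc, Fin.succ_castSucc, Fin.snoc_castSucc, Fin.val_castSucc, h1]
  · have h1 := hΔ' t le_rfl
    unfold hist at h1
    rw [Fin.snoc_castSucc, Fin.succ_last, Fin.snoc_last, Fin.val_last, h1]
    rfl

lemma pw_nonneg (μ lam : ℕ) (Δ : ℕ → (ℕ → ℕ) → ℝ) (hΔ : ∀ t h, 0 ≤ Δ t h) (t : ℕ)
    (path : Fin (t + 1) → Fin (μ + 1)) : 0 ≤ pw μ lam Δ t path := by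
  refine Finset.prod_nonneg fun s _ => binomTruncPr_nonneg' _ _ _ ?_ (min_le_left _ _) _
  exact le_min zero_le_one (div_nonneg (add_nonneg (by positivity) (hΔ _ _)) (by positivity))

/-- the expectation of `f (X_t)` on the event of survival -/
noncomputable def W (μ lam : ℕ) (Δ : ℕ → (ℕ → ℕ) → ℝ) (X₀ : ℕ) (X' : ℝ) (f : ℕ → ℝ) (t : ℕ) : ℝ :=
  ∑ path : Fin (t + 1) → Fin (μ + 1),
    if (path 0).val = X₀ ∧ ∀ s : Fin (t + 1), ((path s).val : ℝ) < X' then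
      pw μ lam Δ t path * f (path (Fin.last t)).val else 0

lemma surv_eq (μ lam : ℕ) (Δ : ℕ → (ℕ → ℕ) → ℝ) (X₀ : ℕ) (X' : ℝ) (t : ℕ) :
    survBelow μ lam Δ X₀ X' t = W μ lam Δ X₀ X' (fun _ => 1) t := by
  unfold survBelow W
  rw [Finset.sum_filter]
  simp only [mul_one]
  rfl

lemma W_step (μ lam : ℕ) (Δ : ℕ → (ℕ → ℕ) → ℝ) (hΔ0 : ∀ t h, 0 ≤ Δ t h)
    (hadapted : ∀ t (h h' : ℕ → ℕ), (∀ s ≤ t, h s = h' s) → Δ t h = Δ t h')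
    (X₀ : ℕ) (X' : ℝ) (f : ℕ → ℝ)
    (hf : ∀ t (h : ℕ → ℕ) (x : ℕ), (x : ℝ) < X' → ∑ y : Fin (μ + 1), (if ((y.val : ℕ) : ℝ) < X' then
        binomTruncPr μ lam (min 1 (((x:ℝ) + Δ t h) / (Real.exp 1 * (μ : ℝ)))) y.val
          * f y.val else 0) ≤ f x - 1) (t : ℕ) :
    W μ lam Δ X₀ X' f (t + 1) + survBelow μ lam Δ X₀ X' t ≤ W μ lam Δ X₀ X' f t := by
  rw [surv_eq]
  unfold W
  rw [← (Fin.snocEquiv (fun _ : Fin (t + 2) => Fin (μ + 1))).sum_comp, Fintype.sum_prod_type_right,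
    ← Finset.sum_add_distrib]
  refine Finset.sum_le_sum fun path _ => ?_
  have hcond : ∀ y : Fin (μ + 1),
      (((Fin.snoc (α := fun _ => Fin (μ + 1)) path y : Fin (t + 2) → Fin (μ + 1)) 0).val = X₀ ∧
        ∀ s : Fin (t + 2), (((Fin.snoc (α := fun _ => Fin (μ + 1)) path y :
          Fin (t + 2) → Fin (μ + 1)) s).val : ℝ) < X') ↔
      (((path 0).val = X₀ ∧ ∀ s : Fin (t + 1), ((path s).val : ℝ) < X') ∧ (y.val : ℝ) < X') := by
    intro y
    have h0 : (Fin.snoc (α := fun _ => Fin (μ + 1)) path y : Fin (t + 2) → Fin (μ + 1)) 0 = path 0 := by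
      have : (0 : Fin (t + 2)) = (0 : Fin (t+1)).castSucc := rfl
      rw [this, Fin.snoc_castSucc]
    rw [h0, Fin.forall_fin_succ']
    simp only [Fin.snoc_castSucc, Fin.snoc_last]
    tauto
  simp only [Fin.snocEquiv, Equiv.coe_fn_mk]
  simp only [hcond, pw_snoc μ lam Δ hadapted, Fin.snoc_last]
  by_cases hc : (path 0).val = X₀ ∧ ∀ s : Fin (t + 1), ((path s).val : ℝ) < X'
  · simp only [hc, true_and, if_true, implies_true, and_self]
    have h1 := hf t (hist μ t path) (path (Fin.last t)).val (hc.2 _)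
    have h2 := mul_le_mul_of_nonneg_left h1 (pw_nonneg μ lam Δ hΔ0 t path)
    rw [Finset.mul_sum] at h2
    simp only [mul_ite, mul_zero, ← mul_assoc] at h2
    linarith
  · simp [hc]

lemma drift (μ lam : ℕ) (Δ : ℕ → (ℕ → ℕ) → ℝ) (hΔ0 : ∀ t h, 0 ≤ Δ t h)
    (hadapted : ∀ t (h h' : ℕ → ℕ), (∀ s ≤ t, h s = h' s) → Δ t h = Δ t h')
    (X₀ : ℕ) (X' : ℝ) (hX₀ : (X₀ : ℝ) < X') (f : ℕ → ℝ) (hf0 : ∀ x : ℕ, (x : ℝ) < X' → 0 ≤ f x)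
    (hf : ∀ t (h : ℕ → ℕ) (x : ℕ), (x : ℝ) < X' → ∑ y : Fin (μ + 1), (if ((y.val : ℕ) : ℝ) < X' then
        binomTruncPr μ lam (min 1 (((x:ℝ) + Δ t h) / (Real.exp 1 * (μ : ℝ)))) y.val
          * f y.val else 0) ≤ f x - 1) :
    (∑' t : ℕ, ENNReal.ofReal (survBelow μ lam Δ X₀ X' t)) ≤ ENNReal.ofReal (f X₀) := by
  have hW0 : ∀ t, 0 ≤ W μ lam Δ X₀ X' f t := by
    intro t
    refine Finset.sum_nonneg fun path _ => ?_
    split_ifs with h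
    · exact mul_nonneg (pw_nonneg μ lam Δ hΔ0 t path) (hf0 _ (h.2 _))
    · exact le_rfl
  have hs0 : ∀ t, 0 ≤ survBelow μ lam Δ X₀ X' t := by
    intro t
    rw [surv_eq]
    refine Finset.sum_nonneg fun path _ => ?_
    split_ifs with h
    · exact mul_nonneg (pw_nonneg μ lam Δ hΔ0 t path) zero_le_one
    · exact le_rfl
  have hW : W μ lam Δ X₀ X' f 0 ≤ f X₀ := by
    unfold W pw
    haveI : Unique (Fin (0 + 1)) := inferInstanceAs (Unique (Fin 1))
    rw [← (Equiv.funUnique (Fin (0 + 1)) (Fin (μ + 1))).symm.sum_comp]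
    have hfX := hf0 X₀ hX₀
    by_cases hX : X₀ < μ + 1
    · rw [Finset.sum_eq_single (⟨X₀, hX⟩ : Fin (μ + 1))]
      · split_ifs
        · simp
        · exact hfX
      · intro b _ hb
        rw [if_neg]
        rintro ⟨h, _⟩
        exact hb (Fin.ext h)
      · simp
    · rw [Finset.sum_eq_zero]
      · exact hfX
      · intro b _
        rw [if_neg]
        rintro ⟨h, _⟩
        have h' : b.val = X₀ := h
        omega
  have hpart : ∀ n, ∑ t ∈ range n, survBelow μ lam Δ X₀ X' t + W μ lam Δ X₀ X' f n ≤ f X₀ := by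
    intro n
    induction n with
    | zero => simpa using hW
    | succ n ih =>
      rw [Finset.sum_range_succ]
      have := W_step μ lam Δ hΔ0 hadapted X₀ X' f hf n
      linarith
  refine ENNReal.tsum_le_of_sum_range_le fun n => ?_
  rw [← ENNReal.ofReal_sum_of_nonneg fun i _ => hs0 i]
  apply ENNReal.ofReal_le_ofReal
  have := hpart n
  have := hW0 n
  linarith

/-- Let `λ ≥ eμ`, let `(X_t)` and `(Δ_t)` be adapted processes with
`Δ_t ≥ Δ_min ∈ (0, λ)` and `X_{t+1} ~ min{μ, Bin(λ, min{1, (X_t + Δ_t)/(eμ)})}`,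
and let `T` be the first time with `X_T ≥ X'`, where
`max{18 ln(2λ/Δ_min), 48} ≤ X' ≤ μ/2`.  Then
`E[T] = ∑_t Pr[T > t] ≤ max{24, (4X' - 2X₀)/Δ_min}`. -/
theorem stmt6 (μ lam : ℕ) (hμ : 0 < μ) (hlam : Real.exp 1 * (μ : ℝ) ≤ (lam : ℝ))
    (Δ : ℕ → (ℕ → ℕ) → ℝ) (Δmin : ℝ) (hΔmin₁ : 0 < Δmin) (hΔmin₂ : Δmin < (lam : ℝ))
    (hΔ : ∀ t h, Δmin ≤ Δ t h)
    (hadapted : ∀ t (h h' : ℕ → ℕ), (∀ s ≤ t, h s = h' s) → Δ t h = Δ t h')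
    (X₀ : ℕ) (hX₀ : X₀ ≤ μ) (X' : ℝ)
    (hX'lb : max (18 * Real.log (2 * (lam : ℝ) / Δmin)) 48 ≤ X')
    (hX'ub : X' ≤ (μ : ℝ) / 2) :
    (∑' t : ℕ, ENNReal.ofReal (survBelow μ lam Δ X₀ X' t))
      ≤ ENNReal.ofReal (max 24 ((4 * X' - 2 * (X₀ : ℝ)) / Δmin)) := by
  have h48 : 48 ≤ X' := (le_max_right _ _).trans hX'lb
  have hlog : 18 * Real.log (2 * (lam : ℝ) / Δmin) ≤ X' := (le_max_left _ _).trans hX'lb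
  have hlam0 : (0:ℝ) < lam := hΔmin₁.trans hΔmin₂
  have hΔ0 : ∀ t h, 0 ≤ Δ t h := fun t h => hΔmin₁.le.trans (hΔ t h)
  by_cases hX : X' ≤ (X₀ : ℝ)
  · have : ∀ t, survBelow μ lam Δ X₀ X' t = 0 := by
      intro t
      rw [surv_eq]
      refine Finset.sum_eq_zero fun path _ => ?_
      rw [if_neg]
      rintro ⟨h, h2⟩
      have := h2 0
      rw [h] at this
      linarith
    simp [this]
  push Not at hX
  have key : ∀ K D : ℝ, 0 ≤ K → 0 < D → D ≤ X' / 2 → D ≤ Δmin →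
      (∀ k : ℕ, k ≤ lam → (k : ℝ) - 2 * X' ≤ K * Real.exp (1/3 * (k - 2 * X'))) →
      K * Real.exp (-X' / 18) ≤ D / 2 →
      (∑' t : ℕ, ENNReal.ofReal (survBelow μ lam Δ X₀ X' t))
        ≤ ENNReal.ofReal (2 / D * (2 * X' - X₀)) := by
    intro K D hK0 hD hDa hDm hK hKD
    refine drift μ lam Δ hΔ0 hadapted X₀ X' hX (fun x => 2 / D * (2 * X' - x)) ?_ ?_
    · intro x hx
      have : 0 ≤ 2 * X' - x := by linarith
      positivity
    · intro t h x hx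
      exact one_step μ lam hμ hlam X' K D h48 hX'ub hK0 hD hDa hK hKD x (Δ t h)
        (Nat.cast_nonneg x) hx (hDm.trans (hΔ t h))
  by_cases hc : Δmin ≤ X' / 2
  · refine (key lam Δmin hlam0.le hΔmin₁ hc le_rfl ?_ ?_).trans ?_
    · intro k hk
      have hk' : (k:ℝ) ≤ lam := by exact_mod_cast hk
      rcases le_total ((k:ℝ) - 2 * X') 0 with h | h
      · exact h.trans (by positivity)
      · have : 1 ≤ Real.exp (1/3 * ((k:ℝ) - 2 * X')) := Real.one_le_exp (by positivity)
        nlinarith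
    · have h1 : -X' / 18 ≤ - Real.log (2 * (lam : ℝ) / Δmin) := by linarith
      have h2 := Real.exp_le_exp.2 h1
      rw [Real.exp_neg, Real.exp_log (by positivity)] at h2
      have h3 := mul_le_mul_of_nonneg_left h2 hlam0.le
      have h4 : (lam:ℝ) * (2 * (lam : ℝ) / Δmin)⁻¹ = Δmin / 2 := by field_simp
      linarith
    · apply ENNReal.ofReal_le_ofReal
      refine le_trans (le_of_eq ?_) (le_max_right _ _)
      field_simp; ring
  · push Not at hc
    refine (key 3 (X' / 2) (by norm_num) (by linarith) le_rfl hc.le ?_ ?_).trans ?_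
    · intro k _
      have := Real.add_one_le_exp (1/3 * ((k:ℝ) - 2 * X'))
      linarith
    · have : Real.exp (-X' / 18) ≤ 1 := Real.exp_le_one_iff.2 (by linarith)
      linarith
    · apply ENNReal.ofReal_le_ofReal
      refine le_trans ?_ (le_max_left _ _)
      have hx0 : (0:ℝ) ≤ X₀ := Nat.cast_nonneg _
      have hpos : 0 < X' := by linarith
      have e : 2 / (X' / 2) * (2 * X' - X₀) = 4 * (2 * X' - X₀) / X' := by field_simp; ring
      rw [e, div_le_iff₀ hpos]
      linarith
end

section
/- Let μ, λ : ℕ → ℕ with μ(n) ≤ λ(n), and let ε : ℕ → (0,1) satisfy ε(n)·√n → ∞ as n → ∞ and λ(n) ≤ (1 − ε(n))·e·μ(n) for all n. Then the expected runtime E[T_n] of the (μ(n), λ(n)) EA on the n-dimensional OneMax function is super-polynomial in n: for every constant k ∈ ℕ there exists n_0 such that E[T_n] ≥ n^k for all n ≥ n_0. -/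
open Finset
open scoped ENNReal

attribute [local instance] Classical.propDecidable

noncomputable def hp {n : ℕ} (r : ℝ) (x : Pt n) : ℝ := ∏ i, if x i = true then 1 else r

noncomputable def hS {n μ : ℕ} (r : ℝ) (P : Fin μ → Pt n) : ℝ := ∑ i, hp r (P i)

lemma hp_nonneg {n : ℕ} {r : ℝ} (hr : 0 ≤ r) (x : Pt n) : 0 ≤ hp r x :=
  Finset.prod_nonneg fun i _ => by split_ifs <;> linarith

lemma hS_nonneg {n μ : ℕ} {r : ℝ} (hr : 0 ≤ r) (P : Fin μ → Pt n) : 0 ≤ hS r P :=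
  Finset.sum_nonneg fun i _ => hp_nonneg hr _

lemma one_le_hS {n μ : ℕ} {r : ℝ} (hr : 0 ≤ r) (P : Fin μ → Pt n)
    (h : ¬ ∀ i, P i ≠ allOnes n) : 1 ≤ hS r P := by
  push Not at h
  obtain ⟨i, hi⟩ := h
  have h1 : hp r (P i) = 1 := by simp [hp, hi, allOnes]
  rw [← h1]
  exact Finset.single_le_sum (f := fun i => hp r (P i)) (fun i _ => hp_nonneg hr _) (Finset.mem_univ i)

lemma sum_prod_pt {n : ℕ} (F : Fin n → Bool → ℝ) :
    ∑ y : Pt n, ∏ i, F i (y i) = ∏ i, (F i true + F i false) := by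
  have := (Finset.prod_univ_sum (fun _ : Fin n => (univ : Finset Bool)) F)
  rw [Fintype.piFinset_univ] at this
  rw [← this]
  simp

lemma mut_sum {n : ℕ} (x : Pt n) : ∑ y, mutProb n x y = 1 := by
  unfold mutProb
  rw [sum_prod_pt (fun i b => if b = x i then 1 - 1 / (n : ℝ) else 1 / (n : ℝ))]
  apply Finset.prod_eq_one
  intro i _
  cases x i <;> simp

lemma mut_nonneg {n : ℕ} (hn : 1 ≤ n) (x y : Pt n) : 0 ≤ mutProb n x y := by
  apply Finset.prod_nonneg
  intro i _
  have : (1:ℝ) ≤ n := by exact_mod_cast hn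
  have h2 : 1 / (n:ℝ) ≤ 1 := by rw [div_le_one (by linarith)]; exact this
  split_ifs
  · linarith
  · positivity

lemma off_nonneg {n μ : ℕ} (hn : 1 ≤ n) (P : Fin μ → Pt n) (y : Pt n) : 0 ≤ offProb n μ P y :=
  div_nonneg (Finset.sum_nonneg fun i _ => mut_nonneg hn _ _) (Nat.cast_nonneg _)

lemma off_sum {n μ : ℕ} (hμ : 0 < μ) (P : Fin μ → Pt n) : ∑ y, offProb n μ P y = 1 := by
  unfold offProb
  rw [← Finset.sum_div, Finset.sum_comm]
  simp only [mut_sum]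
  have : (μ:ℝ) ≠ 0 := by positivity
  simp [this]

lemma sum_prod_gen {X : Type} [Fintype X] {m : ℕ} (F : Fin m → X → ℝ) :
    ∑ o : Fin m → X, ∏ j, F j (o j) = ∏ j, ∑ y, F j y := by
  have := (Finset.prod_univ_sum (fun _ : Fin m => (univ : Finset X)) F)
  rw [Fintype.piFinset_univ] at this
  exact this.symm

lemma offVec_nonneg {n μ lam : ℕ} (hn : 1 ≤ n) (P : Fin μ → Pt n) (o : Fin lam → Pt n) :
    0 ≤ offVecProb n μ lam P o := Finset.prod_nonneg fun _ _ => off_nonneg hn _ _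

lemma offVec_sum {n μ lam : ℕ} (hμ : 0 < μ) (P : Fin μ → Pt n) :
    ∑ o, offVecProb n μ lam P o = 1 := by
  unfold offVecProb
  rw [sum_prod_gen (fun _ => offProb n μ P)]
  simp [off_sum hμ]

lemma offVec_marg {n μ lam : ℕ} (hμ : 0 < μ) (P : Fin μ → Pt n) (h : Pt n → ℝ) (j : Fin lam) :
    ∑ o, offVecProb n μ lam P o * h (o j) = ∑ y, offProb n μ P y * h y := by
  unfold offVecProb
  have : ∀ o : Fin lam → Pt n, (∏ j, offProb n μ P (o j)) * h (o j) =
      ∏ j', (fun (j' : Fin lam) y => offProb n μ P y * (if j' = j then h y else 1)) j' (o j') := by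
    intro o
    simp only [Finset.prod_mul_distrib]
    congr 1
    simp
  simp only [this]
  rw [sum_prod_gen (fun (j' : Fin lam) y => offProb n μ P y * (if j' = j then h y else 1))]
  rw [Finset.prod_eq_single j]
  · simp
  · intro b _ hb
    simp [hb, off_sum hμ]
  · simp

lemma exists_validSel {n μ lam : ℕ} (hle : μ ≤ lam) (o : Fin lam → Pt n) :
    ∃ s : Fin μ → Fin lam, validSel o s := by
  let f : Fin lam → ℕᵒᵈ := fun j => OrderDual.toDual (oneMax (o j))
  let σ := Tuple.sort f
  have hm : Monotone (f ∘ σ) := Tuple.monotone_sort f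
  refine ⟨fun i => σ (Fin.castLE hle i), ?_, ?_⟩
  · exact σ.injective.comp (Fin.castLE_injective hle)
  · intro j hj i
    have h1 : Fin.castLE hle i ≤ σ.symm j := by
      by_contra hlt
      push Not at hlt
      have h2 : (σ.symm j).val < μ := lt_trans hlt i.2
      apply hj ⟨(σ.symm j).val, h2⟩
      have : Fin.castLE hle ⟨(σ.symm j).val, h2⟩ = σ.symm j := by ext; simp
      show σ (Fin.castLE hle ⟨(σ.symm j).val, h2⟩) = j
      rw [this]; simp
    have h3 := hm h1
    simp only [Function.comp, Equiv.apply_symm_apply] at h3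
    exact h3

lemma step_nonneg {n μ lam : ℕ} (hn : 1 ≤ n) (P Q : Fin μ → Pt n) :
    0 ≤ stepProb n μ lam P Q :=
  Finset.sum_nonneg fun o _ => mul_nonneg (offVec_nonneg hn _ _) (by positivity)

lemma step_integral {n μ lam : ℕ} (P : Fin μ → Pt n) (φ : (Fin μ → Pt n) → ℝ) :
    ∑ Q, stepProb n μ lam P Q * φ Q = ∑ o : Fin lam → Pt n, offVecProb n μ lam P o *
      ((∑ s ∈ univ.filter (fun s : Fin μ → Fin lam => validSel o s), φ (o ∘ s)) /
        ((univ.filter (fun s : Fin μ → Fin lam => validSel o s)).card : ℝ)) := by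
  unfold stepProb
  simp only [Finset.sum_mul]
  rw [Finset.sum_comm]
  refine Finset.sum_congr rfl fun o _ => ?_
  have key : ∑ s ∈ univ.filter (fun s : Fin μ → Fin lam => validSel o s), φ (o ∘ s) =
      ∑ Q, ((univ.filter (fun s : Fin μ → Fin lam => validSel o s ∧ o ∘ s = Q)).card : ℝ) * φ Q := by
    rw [← Finset.sum_fiberwise (univ.filter (fun s : Fin μ → Fin lam => validSel o s))
      (fun s => o ∘ s)]
    refine Finset.sum_congr rfl fun Q _ => ?_
    rw [Finset.filter_filter, Finset.sum_congr rfl (g := fun _ => φ Q)]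
    · simp
    · intro s hs
      rw [(Finset.mem_filter.1 hs).2.2]
  rw [key, Finset.sum_div, Finset.mul_sum]
  refine Finset.sum_congr rfl fun Q _ => ?_
  ring

lemma card_valid_pos {n μ lam : ℕ} (hle : μ ≤ lam) (o : Fin lam → Pt n) :
    (0:ℝ) < ((univ.filter (fun s : Fin μ → Fin lam => validSel o s)).card : ℝ) := by
  obtain ⟨s, hs⟩ := exists_validSel hle o
  exact_mod_cast Finset.card_pos.2 ⟨s, by simp [hs]⟩

lemma step_sum {n μ lam : ℕ} (hμ : 0 < μ) (hle : μ ≤ lam) (P : Fin μ → Pt n) :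
    ∑ Q, stepProb n μ lam P Q = 1 := by
  have := step_integral (lam := lam) P (fun _ => 1)
  simp only [mul_one] at this
  rw [this]
  refine Eq.trans ?_ (offVec_sum (lam := lam) hμ P)
  refine Finset.sum_congr rfl fun o _ => ?_
  have := card_valid_pos hle o
  rw [Finset.sum_const, nsmul_eq_mul, mul_one, div_self this.ne', mul_one]

lemma step_hS {n μ lam : ℕ} (hn : 1 ≤ n) (hμ : 0 < μ) (hle : μ ≤ lam) {r : ℝ} (hr : 0 ≤ r)
    (P : Fin μ → Pt n) :
    ∑ Q, stepProb n μ lam P Q * hS r Q ≤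
      ∑ i, (lam : ℝ) / μ * ∑ y, mutProb n (P i) y * hp r y := by
  rw [step_integral]
  calc _ ≤ ∑ o : Fin lam → Pt n, offVecProb n μ lam P o * ∑ j, hp r (o j) := by
        refine Finset.sum_le_sum fun o _ => mul_le_mul_of_nonneg_left ?_ (offVec_nonneg hn _ _)
        rw [div_le_iff₀ (card_valid_pos hle o), mul_comm, ← nsmul_eq_mul]
        apply Finset.sum_le_card_nsmul
        intro s hs
        have hs := (Finset.mem_filter.1 hs).2.1
        unfold hS
        rw [show ∑ i, hp r ((o ∘ s) i) = ∑ j ∈ univ.map ⟨s, hs⟩, hp r (o j) by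
          rw [Finset.sum_map]; rfl]
        exact Finset.sum_le_sum_of_subset_of_nonneg (Finset.subset_univ _)
          (fun _ _ _ => hp_nonneg hr _)
    _ = ∑ j : Fin lam, ∑ y, offProb n μ P y * hp r y := by
        simp only [Finset.mul_sum]
        rw [Finset.sum_comm]
        exact Finset.sum_congr rfl fun j _ => offVec_marg hμ P (hp r) j
    _ = _ := by
        rw [Finset.sum_const, Finset.card_univ, Fintype.card_fin, nsmul_eq_mul]
        unfold offProb
        rw [← Finset.mul_sum, Finset.sum_comm, div_mul_eq_mul_div, mul_div_assoc, Finset.sum_div]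
        congr 1
        refine Finset.sum_congr rfl fun y _ => ?_
        rw [← Finset.sum_mul]; ring

lemma prod_two {n : ℕ} (x : Pt n) (a b : ℝ) :
    ∏ i, (if x i = true then a else b) =
      a ^ (n - (univ.filter fun i => ¬ x i = true).card) *
        b ^ (univ.filter fun i => ¬ x i = true).card := by
  rw [Finset.prod_ite]
  simp only [Finset.prod_const]
  congr 2
  have := Finset.card_filter_add_card_filter_not (s := (univ : Finset (Fin n))) (fun i => x i = true)
  simp only [Finset.card_univ, Fintype.card_fin] at this
  omega

lemma mut_hp {n : ℕ} (x : Pt n) (r : ℝ) :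
    ∑ y, mutProb n x y * hp r y =
      ∏ i, (if x i = true then 1 - (1 - r) / n else r + (1 - r) / n) := by
  unfold mutProb hp
  simp only [← Finset.prod_mul_distrib]
  rw [sum_prod_pt (fun i b => (if b = x i then 1 - 1 / (n : ℝ) else 1 / (n : ℝ)) *
    (if b = true then 1 else r))]
  refine Finset.prod_congr rfl fun i _ => ?_
  cases x i <;> simp <;> ring

/-- main one-individual estimate, exponential part -/
lemma base_est {n d D : ℕ} {r δ : ℝ} (hd : d ≤ D) (hdn : d ≤ n) (hn : 2 ≤ n)
    (hr0 : 0 < r) (hr1 : r ≤ 1) (hδ : r + 2 * D / (r * n) ≤ δ) :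
    (1 - (1 - r) / n) ^ (n - d) * (r + (1 - r) / n) ^ d ≤ r ^ d * Real.exp (δ - 1) := by
  have hn' : (2:ℝ) ≤ n := by exact_mod_cast hn
  have hn0 : (0:ℝ) < n := by linarith
  have ha0 : 0 ≤ 1 - (1 - r) / n := by
    have : (1 - r) / n ≤ 1 := by rw [div_le_one hn0]; linarith
    linarith
  have ha : (1 - (1 - r) / n) ^ (n - d) ≤ Real.exp (-((1 - r) / n) * (n - d)) := by
    rw [show -((1 - r) / n) * ((n:ℝ) - d) = ((n - d : ℕ) : ℝ) * (-((1 - r) / n)) by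
      push_cast [hdn]; ring, Real.exp_nat_mul]
    apply pow_le_pow_left₀ ha0
    have := Real.add_one_le_exp (-((1 - r) / n)); linarith
  have hb : (r + (1 - r) / n) ^ d ≤ r ^ d * Real.exp (d / (r * n)) := by
    rw [show (d:ℝ) / (r * n) = (d:ℝ) * (1 / (r * n)) by ring, Real.exp_nat_mul, ← mul_pow]
    have h0 : 0 ≤ (1 - r) / n := div_nonneg (by linarith) hn0.le
    apply pow_le_pow_left₀ (by linarith)
    have := Real.add_one_le_exp (1 / (r * n))
    have h2 : r * (1 / (r * n) + 1) ≤ r * Real.exp (1 / (r * n)) :=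
      mul_le_mul_of_nonneg_left this hr0.le
    have h3 : r * (1 / (r * n) + 1) = r + 1 / n := by field_simp; ring
    have h4 : (1 - r) / n ≤ 1 / n := by gcongr; linarith
    linarith
  have h0 : 0 ≤ (r + (1 - r) / n) ^ d := by
    have h0 : 0 ≤ (1 - r) / n := div_nonneg (by linarith) hn0.le
    positivity
  calc _ ≤ Real.exp (-((1 - r) / n) * (n - d)) * (r ^ d * Real.exp (d / (r * n))) :=
        mul_le_mul ha hb h0 (Real.exp_nonneg _)
    _ = r ^ d * Real.exp (-((1 - r) / n) * (n - d) + d / (r * n)) := by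
        rw [Real.exp_add]; ring
    _ ≤ _ := by
        apply mul_le_mul_of_nonneg_left _ (by positivity)
        apply Real.exp_le_exp.2
        have hdD : (d:ℝ) ≤ D := by exact_mod_cast hd
        have e1 : -((1 - r) / n) * ((n:ℝ) - d) = -1 + r + (1 - r) * (d / n) := by
          field_simp; ring
        have e2 : (d:ℝ) / n ≤ D / (r * n) := by
          apply div_le_div₀ (by positivity) hdD (by positivity)
          nlinarith
        have e3 : (d:ℝ) / (r * n) ≤ D / (r * n) := by gcongr
        have e4 : (1 - r) * ((d:ℝ) / n) ≤ d / n := by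
          have : 0 ≤ (d:ℝ) / n := by positivity
          nlinarith
        have e5 : 2 * (D:ℝ) / (r * n) = D / (r * n) + D / (r * n) := by ring
        linarith

lemma indiv_est {n D : ℕ} {r δ q : ℝ} (hDn : D ≤ n) (hn : 2 ≤ n)
    (hr0 : 0 < r) (hr1 : r ≤ 1) (hδ : r + 2 * D / (r * n) ≤ δ) (hq0 : 0 ≤ q)
    (hq : q ≤ Real.exp (1 - δ)) (x : Pt n) :
    q * ∑ y, mutProb n x y * hp r y ≤ hp r x + r ^ D := by
  have hn' : (2:ℝ) ≤ n := by exact_mod_cast hn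
  have hn0 : (0:ℝ) < n := by linarith
  have h0 : 0 ≤ (1 - r) / n := div_nonneg (by linarith) hn0.le
  have hqe : q * Real.exp (δ - 1) ≤ 1 := by
    calc _ ≤ Real.exp (1 - δ) * Real.exp (δ - 1) := by gcongr
      _ = 1 := by rw [← Real.exp_add]; simp
  rw [mut_hp, prod_two]
  unfold hp
  rw [prod_two]
  set d := (univ.filter fun i => ¬ x i = true).card with hd
  have hdn : d ≤ n := by
    have := Finset.card_le_univ (univ.filter fun i => ¬ x i = true)
    rwa [Fintype.card_fin] at this
  rw [one_pow, one_mul]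
  have key : ∀ e : ℕ, q * (r ^ e * Real.exp (δ - 1)) ≤ r ^ e := by
    intro e
    have : 0 ≤ r ^ e := by positivity
    nlinarith
  rcases le_total d D with h | h
  · have := base_est h hdn hn hr0 hr1 hδ
    have h2 := mul_le_mul_of_nonneg_left this hq0
    have h3 : 0 ≤ r ^ D := by positivity
    linarith [key d]
  · have := base_est (le_refl D) hDn hn hr0 hr1 hδ
    have h2 := mul_le_mul_of_nonneg_left this hq0
    have h3 : 0 ≤ r ^ d := by positivity
    have hba : r + (1 - r) / n ≤ 1 - (1 - r) / n := by
      have : (1 - r) / n ≤ (1 - r) / 2 := by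
        apply div_le_div_of_nonneg_left (by linarith) (by norm_num) hn'
      linarith
    have h4 : (1 - (1 - r) / n) ^ (n - d) * (r + (1 - r) / n) ^ d ≤
        (1 - (1 - r) / n) ^ (n - D) * (r + (1 - r) / n) ^ D := by
      rw [show n - D = (n - d) + (d - D) by omega, show d = D + (d - D) by omega, pow_add, pow_add,
        show D + (d - D) - D = d - D by omega]
      have hb : 0 ≤ r + (1 - r) / n := by linarith
      have h5 : (r + (1 - r) / n) ^ (d - D) ≤ (1 - (1 - r) / n) ^ (d - D) :=
        pow_le_pow_left₀ hb hba _
      rw [mul_assoc, mul_comm ((r + (1 - r) / n) ^ D)]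
      have ha : 0 ≤ 1 - (1 - r) / n := by linarith
      gcongr
    have h5 := mul_le_mul_of_nonneg_left h4 hq0
    linarith [key D]

/-- survival functional -/
noncomputable def WW (n μ lam t : ℕ) (φ : (Fin μ → Pt n) → ℝ) : ℝ :=
  ∑ path : Fin (t + 1) → Fin μ → Pt n,
    if (∀ s i, path s i ≠ allOnes n) then pathProb n μ lam path * φ (path (Fin.last t)) else 0

lemma surv_eq_s8 (n μ lam t : ℕ) : survProb n μ lam t = WW n μ lam t (fun _ => 1) := by
  unfold survProb WW
  rw [Finset.sum_filter]
  simp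

lemma WW_succ (n μ lam t : ℕ) (φ : (Fin μ → Pt n) → ℝ) :
    WW n μ lam (t + 1) φ = WW n μ lam t (fun P => ∑ Q, stepProb n μ lam P Q *
      (if ∀ i, Q i ≠ allOnes n then φ Q else 0)) := by
  unfold WW
  rw [← (Fin.snocEquiv (fun _ : Fin (t + 2) => Fin μ → Pt n)).sum_comp, Fintype.sum_prod_type,
    Finset.sum_comm]
  refine Finset.sum_congr rfl fun path _ => ?_
  by_cases h : ∀ s i, path s i ≠ allOnes n
  · rw [if_pos h, Finset.mul_sum]
    refine Finset.sum_congr rfl fun Q _ => ?_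
    have hp : pathProb n μ lam (Fin.snocEquiv (fun _ : Fin (t + 2) => Fin μ → Pt n) (Q, path)) =
        pathProb n μ lam path * stepProb n μ lam (path (Fin.last t)) Q := by
      unfold pathProb
      rw [Fin.prod_univ_castSucc, mul_assoc]
      congr 1
      congr 1
      · refine Finset.prod_congr rfl fun s _ => ?_
        congr 1
        · simp [Fin.snocEquiv]
        · rw [Fin.succ_castSucc]; simp only [Fin.snocEquiv, Equiv.coe_fn_mk, Fin.snoc_castSucc]
      · congr 1
        · simp [Fin.snocEquiv]
        · rw [Fin.succ_last]; simp only [Fin.snocEquiv, Equiv.coe_fn_mk, Fin.snoc_last]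
    rw [hp]
    by_cases hQ : ∀ i, Q i ≠ allOnes n
    · rw [if_pos hQ, if_pos]
      · simp [Fin.snocEquiv]; ring
      · intro s
        refine Fin.lastCases ?_ (fun s => ?_) s
        · simpa [Fin.snocEquiv] using hQ
        · simpa [Fin.snocEquiv] using h s
    · rw [if_neg hQ, if_neg]
      · simp
      · intro hh
        apply hQ
        have := hh (Fin.last _)
        simpa [Fin.snocEquiv] using this
  · rw [if_neg h]
    apply Finset.sum_eq_zero
    intro Q _
    rw [if_neg]
    intro hh
    apply h
    intro s
    have := hh s.castSucc
    simpa [Fin.snocEquiv] using this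

lemma path_nonneg {n μ lam t : ℕ} (hn : 1 ≤ n) (path : Fin (t + 1) → Fin μ → Pt n) :
    0 ≤ pathProb n μ lam path :=
  mul_nonneg (by positivity) (Finset.prod_nonneg fun _ _ => step_nonneg hn _ _)

lemma WW_mono {n μ lam t : ℕ} (hn : 1 ≤ n) {φ ψ : (Fin μ → Pt n) → ℝ} (h : ∀ P, φ P ≤ ψ P) :
    WW n μ lam t φ ≤ WW n μ lam t ψ := by
  refine Finset.sum_le_sum fun path _ => ?_
  split_ifs
  · exact mul_le_mul_of_nonneg_left (h _) (path_nonneg hn _)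
  · exact le_rfl

lemma WW_lin {n μ lam t : ℕ} (φ ψ : (Fin μ → Pt n) → ℝ) (c : ℝ) :
    WW n μ lam t (fun P => φ P + c * ψ P) = WW n μ lam t φ + c * WW n μ lam t ψ := by
  unfold WW
  rw [Finset.mul_sum, ← Finset.sum_add_distrib]
  refine Finset.sum_congr rfl fun path _ => ?_
  split_ifs <;> ring

lemma init_sum (n μ : ℕ) : ∑ _P : Fin μ → Pt n, ((1:ℝ) / 2 ^ n) ^ μ = 1 := by
  simp [← mul_pow]

lemma init_hS (n μ : ℕ) (r : ℝ) :
    ∑ P : Fin μ → Pt n, ((1:ℝ) / 2 ^ n) ^ μ * hS r P = μ * ((1 + r) / 2) ^ n := by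
  have hsum : ∑ y : Pt n, hp r y = (1 + r) ^ n := by
    unfold hp
    rw [sum_prod_pt (fun _ b => if b = true then (1:ℝ) else r)]
    simp
  have marg : ∀ j : Fin μ, ∑ P : Fin μ → Pt n, ((1:ℝ) / 2 ^ n) ^ μ * hp r (P j) =
      ((1 + r) / 2) ^ n := by
    intro j
    have : ∀ P : Fin μ → Pt n, ((1:ℝ) / 2 ^ n) ^ μ * hp r (P j) =
      ∏ j', (fun (j' : Fin μ) y => ((1:ℝ) / 2 ^ n) * (if j' = j then hp r y else 1)) j' (P j') := by
      intro P
      simp only [Finset.prod_mul_distrib]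
      simp
    simp only [this]
    rw [sum_prod_gen (fun (j' : Fin μ) y => ((1:ℝ) / 2 ^ n) * (if j' = j then hp r y else 1)),
      Finset.prod_eq_single j]
    · simp only [if_true, ← Finset.mul_sum, hsum]
      rw [div_pow]; ring
    · intro b _ hb
      simp [hb]
    · simp
  unfold hS
  simp only [Finset.mul_sum]
  rw [Finset.sum_comm]
  rw [Finset.sum_congr rfl fun j _ => marg j]
  simp

lemma WW_zero (n μ lam : ℕ) (φ : (Fin μ → Pt n) → ℝ) :
    WW n μ lam 0 φ = ∑ P : Fin μ → Pt n, ((1:ℝ) / 2 ^ n) ^ μ *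
      (if ∀ i, P i ≠ allOnes n then φ P else 0) := by
  unfold WW
  rw [← (Equiv.funUnique (Fin 1) (Fin μ → Pt n)).symm.sum_comp]
  refine Finset.sum_congr rfl fun P _ => ?_
  simp [pathProb, Equiv.funUnique]

section main
variable {n μ lam D : ℕ} {r δ : ℝ}

lemma surv_bound (hn : 2 ≤ n) (hμ : 0 < μ) (hle : μ ≤ lam) (hDn : D ≤ n)
    (hr0 : 0 < r) (hr1 : r ≤ 1) (hδ : r + 2 * D / (r * n) ≤ δ)
    (hq : (lam : ℝ) ≤ Real.exp (1 - δ) * μ) (t : ℕ) :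
    survProb n μ lam t ≤ 1 ∧
    WW n μ lam t (hS r) ≤ μ * ((1 + r) / 2) ^ n + t * (μ * r ^ D) ∧
    1 - (t + 1) * (μ * ((1 + r) / 2) ^ n + t * (μ * r ^ D)) ≤ survProb n μ lam t := by
  have hn1 : 1 ≤ n := by omega
  have hμ' : (0:ℝ) < μ := by exact_mod_cast hμ
  have drift : ∀ P : Fin μ → Pt n, ∑ Q, stepProb n μ lam P Q * hS r Q ≤ hS r P + μ * r ^ D := by
    intro P
    refine (step_hS hn1 hμ hle hr0.le P).trans ?_
    have : ∀ i, (lam : ℝ) / μ * ∑ y, mutProb n (P i) y * hp r y ≤ hp r (P i) + r ^ D := fun i =>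
      indiv_est hDn hn hr0 hr1 hδ (by positivity) (by rwa [div_le_iff₀ hμ']) (P i)
    refine (Finset.sum_le_sum fun i _ => this i).trans ?_
    rw [Finset.sum_add_distrib]
    simp [hS]
  have hc : 0 ≤ μ * r ^ D := by positivity
  have hA : 0 ≤ μ * ((1 + r) / 2) ^ n := by positivity
  induction t with
  | zero =>
    refine ⟨?_, ?_, ?_⟩
    · rw [surv_eq_s8, WW_zero, ← init_sum n μ]
      refine Finset.sum_le_sum fun P _ => ?_
      have : (0:ℝ) ≤ (1 / 2 ^ n) ^ μ := by positivity
      split_ifs <;> simp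
    · rw [WW_zero, ← init_hS]
      simp only [Nat.cast_zero, zero_mul, add_zero]
      refine Finset.sum_le_sum fun P _ => ?_
      apply mul_le_mul_of_nonneg_left _ (by positivity)
      split_ifs
      · exact le_rfl
      · exact hS_nonneg hr0.le P
    · rw [surv_eq_s8, WW_zero, ← init_hS]
      simp only [Nat.cast_zero, zero_mul, add_zero, zero_add, one_mul]
      refine le_trans (le_of_eq (congrArg (· - _) (init_sum n μ).symm)) ?_
      rw [← Finset.sum_sub_distrib]
      refine Finset.sum_le_sum fun P _ => ?_
      rw [← mul_one_sub]
      apply mul_le_mul_of_nonneg_left _ (by positivity)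
      split_ifs with h
      · linarith [hS_nonneg hr0.le P]
      · linarith [one_le_hS hr0.le P h]
  | succ t ih =>
    obtain ⟨h1, h2, h3⟩ := ih
    have hs0 : survProb n μ lam (t + 1) ≤ survProb n μ lam t := by
      rw [surv_eq_s8, surv_eq_s8, WW_succ]
      apply WW_mono hn1
      intro P
      refine le_trans ?_ (step_sum hμ hle P).le
      refine Finset.sum_le_sum fun Q _ => ?_
      have := step_nonneg (lam := lam) hn1 P Q
      split_ifs <;> simp [this]
    have hs1 : survProb n μ lam t - (WW n μ lam t (hS r) + μ * r ^ D) ≤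
        survProb n μ lam (t + 1) := by
      have e : WW n μ lam t (fun P => (1 + (-1) * hS r P) + (-(μ * r ^ D)) * 1) ≤
          survProb n μ lam (t + 1) := by
        rw [surv_eq_s8, WW_succ]
        apply WW_mono hn1
        intro P
        have e1 : ∑ Q, (stepProb n μ lam P Q - stepProb n μ lam P Q * hS r Q) ≤
          ∑ Q, stepProb n μ lam P Q * (if ∀ i, Q i ≠ allOnes n then 1 else 0) := by
          refine Finset.sum_le_sum fun Q _ => ?_
          rw [← mul_one_sub]
          apply mul_le_mul_of_nonneg_left _ (step_nonneg hn1 P Q)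
          split_ifs with h
          · linarith [hS_nonneg hr0.le Q]
          · linarith [one_le_hS hr0.le Q h]
        rw [Finset.sum_sub_distrib, step_sum hμ hle] at e1
        linarith [drift P]
      rw [WW_lin (fun P => 1 + (-1) * hS r P) (fun _ => 1), WW_lin (fun _ => 1) (hS r),
        ← surv_eq_s8] at e
      nlinarith
    refine ⟨hs0.trans h1, ?_, ?_⟩
    · have e : WW n μ lam (t + 1) (hS r) ≤
          WW n μ lam t (fun P => hS r P + (μ * r ^ D) * 1) := by
        rw [WW_succ]
        apply WW_mono hn1
        intro P
        rw [mul_one]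
        refine le_trans (Finset.sum_le_sum fun Q _ => ?_) (drift P)
        apply mul_le_mul_of_nonneg_left _ (step_nonneg hn1 P Q)
        split_ifs
        · exact le_rfl
        · exact hS_nonneg hr0.le Q
      rw [WW_lin (hS r) (fun _ => 1), ← surv_eq_s8] at e
      push_cast
      nlinarith
    · push_cast
      have ht : (0:ℝ) ≤ t := by positivity
      nlinarith
end main

lemma runtime_ge {n μ lam T : ℕ} (hlam : 1 ≤ lam) (K : ℝ) (hK : K ≤ T * (1 / 2))
    (h : ∀ t < T, 1 / 2 ≤ survProb n μ lam t) :
    ENNReal.ofReal K ≤ expRuntime n μ lam := by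
  unfold expRuntime expGens
  calc ENNReal.ofReal K ≤ ENNReal.ofReal (∑ t ∈ Finset.range T, survProb n μ lam t) := by
        apply ENNReal.ofReal_le_ofReal
        refine hK.trans ?_
        have := Finset.card_nsmul_le_sum (Finset.range T) (fun t => survProb n μ lam t) (1/2)
          (fun t ht => h t (Finset.mem_range.1 ht))
        simpa using this
    _ = ∑ t ∈ Finset.range T, ENNReal.ofReal (survProb n μ lam t) := by
        apply ENNReal.ofReal_sum_of_nonneg
        intro t ht
        linarith [h t (Finset.mem_range.1 ht)]
    _ ≤ ∑' t : ℕ, ENNReal.ofReal (survProb n μ lam t) := ENNReal.sum_le_tsum _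
    _ ≤ (lam : ℝ≥0∞) * ∑' t : ℕ, ENNReal.ofReal (survProb n μ lam t) := by
        apply le_mul_of_one_le_left (by simp)
        exact_mod_cast hlam
    _ ≤ _ := le_add_self

/-- If `λ(n) ≤ (1-ε(n)) e μ(n)` with `ε(n)·√n → ∞`, then the expected
runtime of the (μ,λ) EA on OneMax is super-polynomial in `n`. -/
theorem stmt8 (μ lam : ℕ → ℕ) (hμpos : ∀ n, 0 < μ n) (hμle : ∀ n, μ n ≤ lam n)
    (ε : ℕ → ℝ) (hε : ∀ n, 0 < ε n ∧ ε n < 1)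
    (hεgrow : Filter.Tendsto (fun n : ℕ => ε n * Real.sqrt (n : ℝ))
      Filter.atTop Filter.atTop)
    (hlam : ∀ n, (lam n : ℝ) ≤ (1 - ε n) * Real.exp 1 * (μ n : ℝ)) :
    ∀ k : ℕ, ∃ n₀ : ℕ, ∀ n ≥ n₀,
      ENNReal.ofReal ((n : ℝ) ^ k) ≤ expRuntime n (μ n) (lam n) := by
  intro k
  set D : ℕ := 12 * k + 4 with hD
  -- large-n facts
  have f1 : ∀ᶠ n : ℕ in Filter.atTop, Real.sqrt (8 * D) ≤ ε n * Real.sqrt (n : ℝ) :=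
    hεgrow.eventually_ge_atTop _
  have f2 : ∀ᶠ n : ℕ in Filter.atTop, (n:ℝ) ^ (2 * k) * (3 / 4 : ℝ) ^ n < 1 / 8 :=
    (tendsto_pow_const_mul_const_pow_of_lt_one (2 * k) (by norm_num) (by norm_num)).eventually_lt_const
      (by norm_num)
  have f3 : ∀ᶠ n : ℕ in Filter.atTop, 16 + 64 * D ^ 2 ≤ n := Filter.eventually_ge_atTop _
  obtain ⟨n₀, h₀⟩ := Filter.eventually_atTop.1 (f1.and (f2.and f3))
  refine ⟨n₀, fun n hn => ?_⟩
  obtain ⟨g1, g2, g3⟩ := h₀ n hn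
  obtain ⟨he0, he1⟩ := hε n
  have hlam1 : 1 ≤ lam n := (hμpos n).trans_le (hμle n)
  rcases lt_or_ge (n ^ k) (μ n) with hbig | hsmall
  · unfold expRuntime
    refine le_trans ?_ le_self_add
    rw [← ENNReal.ofReal_natCast]
    apply ENNReal.ofReal_le_ofReal
    exact_mod_cast hbig.le
  have hDn : D ≤ n := by nlinarith
  have hn16 : 16 ≤ n := by nlinarith
  have hnR : (16:ℝ) ≤ n := by exact_mod_cast hn16
  have hnpos : (0:ℝ) < n := by linarith
  set w : ℝ := Real.sqrt (Real.sqrt n) with hw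
  have hw2 : w ^ 2 = Real.sqrt n := Real.sq_sqrt (Real.sqrt_nonneg _)
  have hw4 : w ^ 4 = n := by
    rw [show w ^ 4 = (w ^ 2) ^ 2 by ring, hw2, Real.sq_sqrt hnpos.le]
  have hwpos : 0 < w := Real.sqrt_pos.2 (Real.sqrt_pos.2 hnpos)
  set δ : ℝ := min (ε n) (1 / w) with hδdef
  have hδ0 : 0 < δ := lt_min he0 (by positivity)
  have hδε : δ ≤ ε n := min_le_left _ _
  have hδw : δ ≤ 1 / w := min_le_right _ _
  have hδ8 : 8 * (D:ℝ) ≤ δ ^ 2 * n := by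
    rcases min_choice (ε n) (1 / w) with h | h
    · rw [hδdef, h]
      have := pow_le_pow_left₀ (Real.sqrt_nonneg _) g1 2
      rw [mul_pow, Real.sq_sqrt hnpos.le, Real.sq_sqrt (by positivity)] at this
      exact this
    · rw [hδdef, h]
      have e : (1 / w) ^ 2 * n = Real.sqrt n := by
        rw [← hw2, ← hw4]; field_simp
      rw [e]
      apply Real.le_sqrt_of_sq_le
      have : 16 + 64 * (D:ℝ) ^ 2 ≤ n := by exact_mod_cast g3
      nlinarith
  have hr0 : 0 < δ / 2 := by positivity
  have hr1 : δ / 2 ≤ 1 / 2 := by linarith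
  have hcond : δ / 2 + 2 * D / (δ / 2 * n) ≤ δ := by
    have : 2 * (D:ℝ) / (δ / 2 * n) ≤ δ / 2 := by
      rw [div_le_iff₀ (by positivity)]
      nlinarith
    linarith
  have hμR : (0:ℝ) < μ n := by exact_mod_cast hμpos n
  have hq : (lam n : ℝ) ≤ Real.exp (1 - δ) * μ n := by
    refine (hlam n).trans ?_
    apply mul_le_mul_of_nonneg_right _ hμR.le
    have := Real.add_one_le_exp (-δ)
    rw [show (1 - δ) = -δ + 1 by ring, Real.exp_add]
    apply mul_le_mul_of_nonneg_right _ (Real.exp_nonneg _)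
    linarith
  have hμn : (μ n : ℝ) ≤ (n:ℝ) ^ k := by exact_mod_cast hsmall
  -- bounds on the two error terms
  have hA : (n:ℝ) ^ k * (μ n * ((1 + δ / 2) / 2) ^ n) ≤ 1 / 8 := by
    calc _ ≤ (n:ℝ) ^ k * ((n:ℝ) ^ k * (3 / 4) ^ n) := by
          have : ((1 + δ / 2) / 2) ^ n ≤ (3 / 4 : ℝ) ^ n :=
            pow_le_pow_left₀ (by positivity) (by linarith) _
          gcongr
      _ = (n:ℝ) ^ (2 * k) * (3 / 4 : ℝ) ^ n := by ring
      _ ≤ _ := g2.le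
  have hR : (δ / 2) ^ D ≤ 1 / (n:ℝ) ^ (3 * k + 1) := by
    calc (δ / 2) ^ D ≤ (1 / w) ^ D := by
          apply pow_le_pow_left₀ hr0.le; linarith
      _ = 1 / (n:ℝ) ^ (3 * k + 1) := by
          rw [← hw4, hD, div_pow, one_pow, ← pow_mul]; congr 2; ring
  have hB : (n:ℝ) ^ k * ((n:ℝ) ^ k * (μ n * (δ / 2) ^ D)) ≤ 1 / 16 := by
    calc _ ≤ (n:ℝ) ^ k * ((n:ℝ) ^ k * ((n:ℝ) ^ k * (1 / (n:ℝ) ^ (3 * k + 1)))) := by gcongr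
      _ = 1 / n := by field_simp; ring
      _ ≤ _ := by
        apply one_div_le_one_div_of_le (by norm_num) hnR
  apply runtime_ge (T := 2 * n ^ k) hlam1
  · push_cast; linarith
  intro t ht
  have hb := (surv_bound (by omega) (hμpos n) (hμle n) hDn hr0 (by linarith) hcond hq t).2.2
  have ht1 : (t:ℝ) + 1 ≤ 2 * (n:ℝ) ^ k := by exact_mod_cast ht
  have ht0 : (t:ℝ) ≤ 2 * (n:ℝ) ^ k := by linarith
  have hfin : ((t:ℝ) + 1) * (μ n * ((1 + δ / 2) / 2) ^ n + t * (μ n * (δ / 2) ^ D)) ≤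
      (2 * (n:ℝ) ^ k) * (μ n * ((1 + δ / 2) / 2) ^ n + (2 * (n:ℝ) ^ k) * (μ n * (δ / 2) ^ D)) := by
    gcongr
  nlinarith
end
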